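/- arXiv:math/9911099 — 3 statements merged into one kernel-verified Lean document; each statement's English description precedes it below -/
import Mathlib

section
/- There exist finitely generated quasi-isometric groups G and H such that G is solvable but H is not virtually solvable. Concretely, one may take G = ℤ ≀ ℤ and H = ℤ ≀ (ℤ ⊕ D) where D is any finite group that is not solvable; these two groups are bi-Lipschitz equivalent (hence quasi-isometric), G is solvable, and H is not virtually solvable. -/
/-- `S` is a finite symmetric generating set of the group `G`. -/
def IsFiniteSymmGen {G : Type*} [Group G] (S : Set G) : Prop :=
  S.Finite ∧ (∀ s ∈ S, s⁻¹ ∈ S) ∧ Subgroup.closure S = ⊤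

/-- The word length of `g` with respect to a generating set `S`. -/
noncomputable def wordLength {G : Type*} [Group G] (S : Set G) (g : G) : ℕ :=
  sInf {n | ∃ l : List G, (∀ x ∈ l, x ∈ S) ∧ l.length = n ∧ l.prod = g}

/-- The right-invariant word metric. -/
noncomputable def wordDist {G : Type*} [Group G] (S : Set G) (x y : G) : ℕ :=
  wordLength S (x * y⁻¹)

/-- The subgroup of finitely supported functions `C → A` inside the product group. -/
def FinSupp (C A : Type*) [Group C] [Group A] : Subgroup (C → A) where
  carrier := {f | (Function.mulSupport f).Finite}
  one_mem' := by simp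
  mul_mem' := by
    intro f g hf hg
    exact (hf.union hg).subset (Function.mulSupport_mul f g)
  inv_mem' := by
    intro f hf
    simpa [Function.mulSupport_inv] using hf

/-- The shift automorphism of `⊕_C A` given by `c : C`. -/
def shiftAut (C A : Type*) [Group C] [Group A] (c : C) : MulAut (FinSupp C A) where
  toFun f := ⟨fun x => (f : C → A) (x * c), by
    have h : Function.mulSupport (fun x => (f : C → A) (x * c)) =
        (fun x : C => x * c) ⁻¹' Function.mulSupport (f : C → A) := rfl
    show (Function.mulSupport fun x => (f : C → A) (x * c)).Finite
    rw [h]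
    exact f.2.preimage ((mul_left_injective c).injOn)⟩
  invFun f := ⟨fun x => (f : C → A) (x * c⁻¹), by
    have h : Function.mulSupport (fun x => (f : C → A) (x * c⁻¹)) =
        (fun x : C => x * c⁻¹) ⁻¹' Function.mulSupport (f : C → A) := rfl
    show (Function.mulSupport fun x => (f : C → A) (x * c⁻¹)).Finite
    rw [h]
    exact f.2.preimage ((mul_left_injective c⁻¹).injOn)⟩
  left_inv := by
    intro f
    exact Subtype.ext (funext fun x => by simp [mul_assoc])
  right_inv := by
    intro f
    exact Subtype.ext (funext fun x => by simp [mul_assoc])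
  map_mul' := by
    intro f g
    rfl

/-- The shift action of `C` on `⊕_C A`, as a homomorphism `C →* MulAut (⊕_C A)`. -/
def shiftHom (C A : Type*) [Group C] [Group A] : C →* MulAut (FinSupp C A) where
  toFun := shiftAut C A
  map_one' := by
    apply MulEquiv.ext
    intro f
    exact Subtype.ext (funext fun x => by simp [shiftAut])
  map_mul' := by
    intro c₁ c₂
    apply MulEquiv.ext
    intro f
    exact Subtype.ext (funext fun x => by simp [shiftAut, mul_assoc])

/-- The (restricted) wreath product `C ≀ A`: the semidirect product of `C` acting by
shifts on `⊕_C A`. -/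
abbrev Wreath (C A : Type*) [Group C] [Group A] :=
  (FinSupp C A) ⋊[shiftHom C A] C

/-- Two groups equipped with generating sets are bi-Lipschitz equivalent. -/
def BiLipschitzEquivalent {G H : Type*} [Group G] [Group H] (SG : Set G) (SH : Set H) : Prop :=
  ∃ (φ : G ≃ H) (K₁ K₂ : ℝ), 0 < K₁ ∧ 0 < K₂ ∧ ∀ x y : G,
    K₂ * (wordDist SH (φ x) (φ y) : ℝ) ≤ (wordDist SG x y : ℝ) ∧
    (wordDist SG x y : ℝ) ≤ K₁ * (wordDist SH (φ x) (φ y) : ℝ)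

/-- `f` is a quasi-isometry between `(X, dX)` and `(Y, dY)`. -/
def IsQuasiIsometry {X Y : Type*} (dX : X → X → ℕ) (dY : Y → Y → ℕ) (f : X → Y) : Prop :=
  ∃ L C : ℝ, 1 ≤ L ∧ 0 ≤ C ∧
    (∀ x x' : X, (dY (f x) (f x') : ℝ) ≤ L * dX x x' + C ∧
      (dX x x' : ℝ) ≤ L * dY (f x) (f x') + C) ∧
    ∀ y : Y, ∃ x : X, (dY (f x) y : ℝ) ≤ C

/-- A group is virtually solvable if it has a solvable subgroup of finite index. -/
def VirtuallySolvable (G : Type*) [Group G] : Prop :=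
  ∃ K : Subgroup G, K.FiniteIndex ∧ IsSolvable K

section WordMetric

variable {G H : Type*} [Group G] [Group H]

theorem exists_isFiniteSymmGen (G : Type*) [Group G] [hG : Group.FG G] :
    ∃ S : Set G, IsFiniteSymmGen S := by
  obtain ⟨S, hS, hfin⟩ := Group.fg_iff.mp hG
  refine ⟨S ∪ S⁻¹, hfin.union hfin.inv, ?_, ?_⟩
  · rintro s (hs | hs)
    · exact Or.inr (by simpa using hs)
    · exact Or.inl hs
  · exact top_le_iff.mp (hS ▸ Subgroup.closure_mono Set.subset_union_left)

theorem wordLength_prod_le {S : Set G} {l : List G} (hl : ∀ x ∈ l, x ∈ S) :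
    wordLength S l.prod ≤ l.length :=
  Nat.sInf_le ⟨l, hl, rfl, rfl⟩

theorem wordLength_one (S : Set G) : wordLength S 1 = 0 :=
  Nat.le_zero.mp (wordLength_prod_le (S := S) (l := []) (by simp))

theorem IsFiniteSymmGen.exists_word {S : Set G} (hS : IsFiniteSymmGen S) (g : G) :
    ∃ l : List G, (∀ x ∈ l, x ∈ S) ∧ l.length = wordLength S g ∧ l.prod = g := by
  have hg : g ∈ Subgroup.closure S := hS.2.2 ▸ Subgroup.mem_top g
  have hne : {n | ∃ l : List G, (∀ x ∈ l, x ∈ S) ∧ l.length = n ∧ l.prod = g}.Nonempty := by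
    rw [← Subgroup.mem_toSubmonoid, Subgroup.closure_toSubmonoid] at hg
    obtain ⟨l, hl, hprod⟩ := Submonoid.exists_list_of_mem_closure hg
    refine ⟨_, l, fun x hx => ?_, rfl, hprod⟩
    rcases hl x hx with h | h
    · exact h
    · simpa using hS.2.1 _ h
  exact Nat.sInf_mem hne

theorem IsFiniteSymmGen.wordLength_mul_le {S : Set G} (hS : IsFiniteSymmGen S) (g h : G) :
    wordLength S (g * h) ≤ wordLength S g + wordLength S h := by
  obtain ⟨l, hl, hlen, hprod⟩ := hS.exists_word g
  obtain ⟨l', hl', hlen', hprod'⟩ := hS.exists_word h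
  have := wordLength_prod_le (S := S) (l := l ++ l') (by
    intro x hx
    rcases List.mem_append.mp hx with hx | hx
    exacts [hl x hx, hl' x hx])
  simpa [hlen, hlen', hprod, hprod'] using this

/-- The elements `g` for which `φ (g * x)` stays at bounded distance from `φ x`, uniformly
in `x`. -/
def boundedDisplacement (φ : G → H) : Subgroup G where
  carrier := {g | (Set.range fun x => φ (g * x) * (φ x)⁻¹).Finite}
  one_mem' := (Set.finite_singleton 1).subset (by rintro _ ⟨x, rfl⟩; simp)
  mul_mem' := by
    intro g h hg hh
    refine (hg.mul hh).subset ?_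
    rintro _ ⟨x, rfl⟩
    exact ⟨_, ⟨h * x, rfl⟩, _, ⟨x, rfl⟩, by simp [mul_assoc]⟩
  inv_mem' := by
    intro g hg
    refine hg.inv.subset ?_
    rintro _ ⟨x, rfl⟩
    exact ⟨g⁻¹ * x, by simp⟩

theorem mem_boundedDisplacement {φ : G → H} {g : G} :
    g ∈ boundedDisplacement φ ↔ (Set.range fun x => φ (g * x) * (φ x)⁻¹).Finite :=
  Iff.rfl

theorem exists_wordDist_map_le {φ : G → H} (hφ : boundedDisplacement φ = ⊤)
    {SG : Set G} {SH : Set H} (hG : IsFiniteSymmGen SG) (hH : IsFiniteSymmGen SH) :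
    ∃ K : ℕ, ∀ x y, wordDist SH (φ x) (φ y) ≤ K * wordDist SG x y := by
  have hfin : (⋃ s ∈ SG, Set.range fun x => φ (s * x) * (φ x)⁻¹).Finite :=
    hG.1.biUnion fun s _ => mem_boundedDisplacement.mp (hφ ▸ Subgroup.mem_top s)
  obtain ⟨K, hK⟩ := (hfin.image (wordLength SH)).bddAbove
  have hstep : ∀ s ∈ SG, ∀ x, wordLength SH (φ (s * x) * (φ x)⁻¹) ≤ K := fun s hs x =>
    hK ⟨_, Set.mem_biUnion hs ⟨x, rfl⟩, rfl⟩
  have hword : ∀ (l : List G), (∀ s ∈ l, s ∈ SG) → ∀ y,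
      wordLength SH (φ (l.prod * y) * (φ y)⁻¹) ≤ K * l.length := by
    intro l
    induction l with
    | nil => simp [wordLength_one]
    | cons s l ih =>
      intro hl y
      have hmul := hH.wordLength_mul_le (φ (s * (l.prod * y)) * (φ (l.prod * y))⁻¹)
        (φ (l.prod * y) * (φ y)⁻¹)
      have hs := hstep s (hl s (by simp)) (l.prod * y)
      have hl' := ih (fun t ht => hl t (by simp [ht])) y
      simp only [mul_assoc, inv_mul_cancel_left] at hmul hs hl'
      simp only [List.prod_cons, List.length_cons, mul_assoc, mul_add, mul_one]
      omega
  refine ⟨K, fun x y => ?_⟩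
  obtain ⟨l, hl, hlen, hprod⟩ := hG.exists_word (x * y⁻¹)
  simpa [wordDist, hlen, hprod] using hword l hl y

theorem exists_biLipschitz {φ : G ≃ H} (hφ : boundedDisplacement φ = ⊤)
    (hφ' : boundedDisplacement φ.symm = ⊤) {SG : Set G} {SH : Set H}
    (hG : IsFiniteSymmGen SG) (hH : IsFiniteSymmGen SH) :
    ∃ L : ℝ, 1 ≤ L ∧ ∀ x y, (wordDist SH (φ x) (φ y) : ℝ) ≤ L * wordDist SG x y ∧
      (wordDist SG x y : ℝ) ≤ L * wordDist SH (φ x) (φ y) := by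
  obtain ⟨K, hK⟩ := exists_wordDist_map_le hφ hG hH
  obtain ⟨K', hK'⟩ := exists_wordDist_map_le hφ' hH hG
  refine ⟨K + K' + 1, by norm_cast; omega, fun x y => ⟨?_, ?_⟩⟩
  · norm_cast
    exact (hK x y).trans (Nat.mul_le_mul_right _ (by omega))
  · norm_cast
    have := hK' (φ x) (φ y)
    simp only [Equiv.symm_apply_apply] at this
    exact this.trans (Nat.mul_le_mul_right _ (by omega))

theorem biLipschitzEquivalent_and_isQuasiIsometry {φ : G ≃ H} (hφ : boundedDisplacement φ = ⊤)
    (hφ' : boundedDisplacement φ.symm = ⊤) {SG : Set G} {SH : Set H}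
    (hG : IsFiniteSymmGen SG) (hH : IsFiniteSymmGen SH) :
    BiLipschitzEquivalent SG SH ∧ IsQuasiIsometry (wordDist SG) (wordDist SH) φ := by
  obtain ⟨L, hL, h⟩ := exists_biLipschitz hφ hφ' hG hH
  have hL₀ : 0 < L := by linarith
  refine ⟨⟨φ, L, L⁻¹, hL₀, inv_pos.mpr hL₀, fun x y => ⟨?_, (h x y).2⟩⟩,
    L, 0, hL, le_rfl, fun x y => by simpa using h x y, fun y => ⟨φ.symm y, ?_⟩⟩
  · exact (inv_mul_le_iff₀ hL₀).mpr (h x y).1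
  · simp [wordDist, wordLength_one]

end WordMetric

section Wreath

variable {C A B : Type*} [Group C] [Group A] [Group B]

open Classical in
/-- The lamp configuration supported at `c`, as a homomorphism from the lamp group. -/
noncomputable def FinSupp.single (c : C) : A →* FinSupp C A :=
  (MonoidHom.mulSingle (fun _ : C => A) c).codRestrict (FinSupp C A) fun _ =>
    (Set.finite_singleton c).subset Pi.mulSupport_mulSingle_subset

theorem FinSupp.single_apply_same (c : C) (a : A) :
    (FinSupp.single c a : C → A) c = a := by
  classical
  exact Pi.mulSingle_eq_same (M := fun _ => A) c a

theorem FinSupp.single_apply_of_ne {c x : C} (h : x ≠ c) (a : A) :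
    (FinSupp.single c a : C → A) x = 1 := by
  classical
  exact Pi.mulSingle_eq_of_ne (M := fun _ => A) h a

theorem FinSupp.shift_single (c : C) (a : A) :
    shiftHom C A c⁻¹ (FinSupp.single 1 a) = FinSupp.single c a := by
  refine Subtype.ext (funext fun x => ?_)
  change (FinSupp.single (1 : C) a : C → A) (x * c⁻¹) = _
  by_cases h : x = c
  · subst h
    simp [FinSupp.single_apply_same]
  · rw [FinSupp.single_apply_of_ne h, FinSupp.single_apply_of_ne]
    rwa [Ne, mul_inv_eq_one]

theorem FinSupp.mem_of_single_mem {K : Subgroup (FinSupp C A)}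
    (hK : ∀ c a, FinSupp.single c a ∈ K) (f : FinSupp C A) : f ∈ K := by
  classical
  suffices h : ∀ (s : Finset C) (f : FinSupp C A), (∀ x ∉ s, (f : C → A) x = 1) → f ∈ K by
    refine h f.2.toFinset f fun x hx => ?_
    exact Function.notMem_mulSupport.mp fun hfx => hx ((Set.Finite.mem_toFinset _).mpr hfx)
  intro s
  induction s using Finset.induction_on with
  | empty =>
    intro f hf
    have : f = 1 := Subtype.ext (funext fun x => hf x (by simp))
    exact this ▸ K.one_mem
  | insert c s _ ih =>
    intro f hf
    have hrest := ih ((FinSupp.single c ((f : C → A) c))⁻¹ * f) fun x hx => by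
      change ((FinSupp.single c ((f : C → A) c) : C → A) x)⁻¹ * (f : C → A) x = 1
      by_cases h : x = c
      · subst h
        simp [FinSupp.single_apply_same]
      · simp [FinSupp.single_apply_of_ne h, hf x (by simp [h, hx])]
    exact (Subgroup.mul_mem_cancel_left K (K.inv_mem (hK _ _))).mp hrest

/-- The wreath product is generated by the moves `C` and the lamp group at `1`. -/
theorem Wreath.eq_top_of_le {K : Subgroup (Wreath C A)}
    (hmove : ∀ c : C, SemidirectProduct.inr c ∈ K)
    (hlamp : ∀ a : A, SemidirectProduct.inl (FinSupp.single 1 a) ∈ K) : K = ⊤ := by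
  have hinl : ∀ f : FinSupp C A, f ∈ K.comap SemidirectProduct.inl := by
    refine FinSupp.mem_of_single_mem fun c a => ?_
    rw [Subgroup.mem_comap, ← FinSupp.shift_single, SemidirectProduct.inl_aut]
    exact K.mul_mem (K.mul_mem (hmove _) (hlamp a)) (hmove _)
  refine (Subgroup.eq_top_iff' K).mpr fun g => ?_
  rw [← SemidirectProduct.inl_left_mul_inr_right g]
  exact K.mul_mem (hinl _) (hmove _)

instance Wreath.fg [Group.FG C] [Group.FG A] : Group.FG (Wreath C A) := by
  have htop : (SemidirectProduct.inr : C →* Wreath C A).range ⊔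
      ((SemidirectProduct.inl : FinSupp C A →* Wreath C A).comp (FinSupp.single 1)).range = ⊤ :=
    Wreath.eq_top_of_le (fun c => Subgroup.mem_sup_left ⟨c, rfl⟩)
      fun a => Subgroup.mem_sup_right ⟨a, rfl⟩
  rw [Group.fg_def, ← htop]
  exact ((Group.fg_iff_subgroup_fg _).mp inferInstance).sup
    ((Group.fg_iff_subgroup_fg _).mp inferInstance)

/-- Apply a map preserving `1` to every lamp. -/
def FinSupp.mapLamp (σ : A → B) (hσ : σ 1 = 1) (f : FinSupp C A) : FinSupp C B :=
  ⟨σ ∘ f, f.2.subset fun x hx h => hx (by simp [h, hσ])⟩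

/-- A bijection of lamp groups preserving `1` induces a bijection of wreath products. -/
def Wreath.congrLamp (σ : A ≃ B) (hσ : σ 1 = 1) : Wreath C A ≃ Wreath C B where
  toFun g := ⟨FinSupp.mapLamp σ hσ g.left, g.right⟩
  invFun g := ⟨FinSupp.mapLamp σ.symm (by simp [← hσ]) g.left, g.right⟩
  left_inv g := SemidirectProduct.ext (Subtype.ext (funext fun x => by simp [FinSupp.mapLamp])) rfl
  right_inv g := SemidirectProduct.ext (Subtype.ext (funext fun x => by simp [FinSupp.mapLamp])) rfl

theorem Wreath.congrLamp_symm (σ : A ≃ B) (hσ : σ 1 = 1) :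
    (Wreath.congrLamp σ hσ : Wreath C A ≃ Wreath C B).symm =
      Wreath.congrLamp σ.symm (by simp [← hσ]) :=
  rfl

theorem Wreath.congrLamp_inr_mul (σ : A ≃ B) (hσ : σ 1 = 1) (c : C) (g : Wreath C A) :
    Wreath.congrLamp σ hσ (SemidirectProduct.inr c * g) =
      SemidirectProduct.inr c * Wreath.congrLamp σ hσ g := by
  refine SemidirectProduct.ext (Subtype.ext (funext fun x => ?_)) rfl
  change σ (1 * (g.left : C → A) (x * c)) = 1 * σ ((g.left : C → A) (x * c))
  simp only [one_mul]

theorem Wreath.congrLamp_single_mul (σ : A ≃ B) (hσ : σ 1 = 1) (a : A) (g : Wreath C A) :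
    Wreath.congrLamp σ hσ (SemidirectProduct.inl (FinSupp.single 1 a) * g) =
      SemidirectProduct.inl (FinSupp.single 1
        (σ (a * (g.left : C → A) 1) * (σ ((g.left : C → A) 1))⁻¹)) *
      Wreath.congrLamp σ hσ g := by
  refine SemidirectProduct.ext (Subtype.ext (funext fun x => ?_)) ?_
  · by_cases h : x = 1
    · subst h
      simp [Wreath.congrLamp, FinSupp.mapLamp, FinSupp.single_apply_same]
    · simp [Wreath.congrLamp, FinSupp.mapLamp, FinSupp.single_apply_of_ne h]
  · simp [Wreath.congrLamp]

theorem Wreath.boundedDisplacement_congrLamp {σ : A ≃ B} (hσ : σ 1 = 1)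
    (h : boundedDisplacement σ = ⊤) :
    boundedDisplacement (Wreath.congrLamp σ hσ : Wreath C A ≃ Wreath C B) = ⊤ := by
  refine Wreath.eq_top_of_le (fun c => ?_) fun a => ?_
  · refine (Set.finite_singleton (SemidirectProduct.inr c)).subset ?_
    rintro _ ⟨g, rfl⟩
    simp [Wreath.congrLamp_inr_mul]
  · have ha := mem_boundedDisplacement.mp (h ▸ Subgroup.mem_top a)
    refine (ha.image fun b => SemidirectProduct.inl (FinSupp.single 1 b)).subset ?_
    rintro _ ⟨g, rfl⟩
    exact ⟨_, ⟨(g.left : C → A) 1, rfl⟩, by simp [Wreath.congrLamp_single_mul]⟩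

theorem Wreath.isSolvable (C A : Type*) [CommGroup C] [CommGroup A] :
    Group.IsSolvable (Wreath C A) :=
  Group.isSolvable_of_ker_le_range (SemidirectProduct.inl : FinSupp C A →* Wreath C A)
    SemidirectProduct.rightHom SemidirectProduct.range_inl_eq_ker_rightHom.ge

theorem Wreath.isSolvable_of_virtuallySolvable [Infinite C] [Finite B]
    (p : A →* B) (s : B →* A) (hps : ∀ b, p (s b) = b) (h : VirtuallySolvable (Wreath C A)) :
    Group.IsSolvable B := by
  obtain ⟨K, hK, hsol⟩ := h
  replace hsol : Group.IsSolvable K := hsol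
  obtain ⟨c, c', hne, heq⟩ := Finite.exists_ne_map_eq_of_infinite
    fun (c : C) (b : B) =>
      QuotientGroup.mk (s := K) (SemidirectProduct.inl (FinSupp.single c (s b)) : Wreath C A)
  have hmem : ∀ b, (FinSupp.single c (s b))⁻¹ * FinSupp.single c' (s b) ∈
      K.comap (SemidirectProduct.inl : FinSupp C A →* Wreath C A) := fun b => by
    simpa using QuotientGroup.eq.mp (congrFun heq b)
  have : Group.IsSolvable (K.comap (SemidirectProduct.inl : FinSupp C A →* Wreath C A)) :=
    Group.isSolvable_of_isSolvable_injective (f := SemidirectProduct.inl.subgroupComap K)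
      fun x y hxy => Subtype.ext (SemidirectProduct.inl_injective (congrArg Subtype.val hxy))
  let proj : K.comap (SemidirectProduct.inl : FinSupp C A →* Wreath C A) →* B :=
    p.comp ((Pi.evalMonoidHom (fun _ : C => A) c).comp
      ((FinSupp C A).subtype.comp (Subgroup.subtype _)))
  refine Group.isSolvable_of_surjective (f := proj) fun b => ⟨⟨_, hmem b⁻¹⟩, ?_⟩
  change p (((FinSupp.single c (s b⁻¹) : C → A) c)⁻¹ *
    (FinSupp.single c' (s b⁻¹) : C → A) c) = b
  rw [FinSupp.single_apply_same, FinSupp.single_apply_of_ne hne]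
  simp [hps]

end Wreath

section Lamps

variable {D : Type*} [Group D]

/-- Euclidean division by `m`, with the remainders labelled by the elements of `D`. -/
def intEquivIntProd {m : ℕ} [NeZero m] (e : Fin m ≃ D) :
    Multiplicative ℤ ≃ Multiplicative ℤ × D :=
  Multiplicative.toAdd.trans ((Int.divModEquiv m).trans (Multiplicative.ofAdd.prodCongr e))

theorem boundedDisplacement_intEquivIntProd [Finite D] {m : ℕ} [NeZero m] (e : Fin m ≃ D) :
    boundedDisplacement (intEquivIntProd e) = ⊤ := by
  have hm : (0 : ℤ) < m := by exact_mod_cast Nat.pos_of_ne_zero (NeZero.ne m)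
  have hone : Multiplicative.ofAdd (1 : ℤ) ∈ boundedDisplacement (intEquivIntProd e) := by
    refine (((Set.finite_Icc (0 : ℤ) 1).preimage
      Multiplicative.toAdd.injective.injOn).prod (Set.finite_univ (α := D))).subset ?_
    rintro _ ⟨n, rfl⟩
    refine ⟨?_, Set.mem_univ _⟩
    change (1 + n.toAdd) / (m : ℤ) - n.toAdd / (m : ℤ) ∈ Set.Icc (0 : ℤ) 1
    have hle : n.toAdd / (m : ℤ) ≤ (1 + n.toAdd) / m := Int.ediv_le_ediv hm (by omega)
    have hge : (1 + n.toAdd) / (m : ℤ) ≤ (n.toAdd + m) / m := Int.ediv_le_ediv hm (by omega)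
    rw [Int.add_ediv_of_dvd_right dvd_rfl, Int.ediv_self hm.ne'] at hge
    exact ⟨by omega, by omega⟩
  refine (Subgroup.eq_top_iff' _).mpr fun a => ?_
  have ha : a = Multiplicative.ofAdd (1 : ℤ) ^ a.toAdd := by
    rw [← ofAdd_zsmul]
    simp
  exact ha ▸ Subgroup.zpow_mem _ hone _

theorem boundedDisplacement_intEquivIntProd_symm {m : ℕ} [NeZero m] (e : Fin m ≃ D) :
    boundedDisplacement (intEquivIntProd e).symm = ⊤ := by
  refine (Subgroup.eq_top_iff' _).mpr fun ⟨a, b⟩ => ?_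
  refine ((Set.finite_Icc (a.toAdd * m - m : ℤ) (a.toAdd * m + m)).preimage
    Multiplicative.toAdd.injective.injOn).subset ?_
  rintro _ ⟨⟨q, d⟩, rfl⟩
  change (a.toAdd + q.toAdd) * (m : ℤ) + (e.symm (b * d) : ℕ) -
    (q.toAdd * (m : ℤ) + (e.symm d : ℕ)) ∈ Set.Icc _ _
  have h₁ := (e.symm (b * d)).isLt
  have h₂ := (e.symm d).isLt
  rw [add_mul]
  exact ⟨by omega, by omega⟩

theorem intEquivIntProd_one {m : ℕ} [NeZero m] {e : Fin m ≃ D} (he : e 0 = 1) :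
    intEquivIntProd e 1 = 1 := by
  rw [← Equiv.eq_symm_apply]
  change (1 : Multiplicative ℤ) = Multiplicative.ofAdd ((0 : ℤ) * m + (e.symm 1 : ℕ))
  simp [← he]

theorem exists_equiv_int_int_prod (D : Type*) [Group D] [Finite D] :
    ∃ σ : Multiplicative ℤ ≃ Multiplicative ℤ × D, σ 1 = 1 ∧
      boundedDisplacement σ = ⊤ ∧ boundedDisplacement σ.symm = ⊤ := by
  have : NeZero (Nat.card D) := ⟨Nat.card_pos.ne'⟩
  let e₀ : Fin (Nat.card D) ≃ D := (Finite.equivFin D).symm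
  let e := e₀.trans (Equiv.mulLeft (e₀ 0)⁻¹)
  exact ⟨intEquivIntProd e, intEquivIntProd_one (by simp [e]),
    boundedDisplacement_intEquivIntProd e, boundedDisplacement_intEquivIntProd_symm e⟩

end Lamps

/-- `G = ℤ ≀ ℤ` and `H = ℤ ≀ (ℤ ⊕ D)` (for `D` a finite non-solvable group)
are finitely generated, bi-Lipschitz equivalent (hence quasi-isometric), `G` is solvable,
and `H` is not virtually solvable. -/
theorem exists_quasiIsometric_solvable_not_virtuallySolvable
    (D : Type*) [Group D] [Finite D] (hD : ¬ IsSolvable D) :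
    Group.FG (Wreath (Multiplicative ℤ) (Multiplicative ℤ)) ∧
    Group.FG (Wreath (Multiplicative ℤ) (Multiplicative ℤ × D)) ∧
    (∃ (SG : Set (Wreath (Multiplicative ℤ) (Multiplicative ℤ)))
       (SH : Set (Wreath (Multiplicative ℤ) (Multiplicative ℤ × D))),
      IsFiniteSymmGen SG ∧ IsFiniteSymmGen SH ∧ BiLipschitzEquivalent SG SH ∧
      ∃ φ : Wreath (Multiplicative ℤ) (Multiplicative ℤ) ≃
            Wreath (Multiplicative ℤ) (Multiplicative ℤ × D),
        IsQuasiIsometry (wordDist SG) (wordDist SH) φ) ∧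
    IsSolvable (Wreath (Multiplicative ℤ) (Multiplicative ℤ)) ∧
    ¬ VirtuallySolvable (Wreath (Multiplicative ℤ) (Multiplicative ℤ × D)) := by
  obtain ⟨σ, hσ, hbd, hbd'⟩ := exists_equiv_int_int_prod D
  obtain ⟨SG, hSG⟩ := exists_isFiniteSymmGen (Wreath (Multiplicative ℤ) (Multiplicative ℤ))
  obtain ⟨SH, hSH⟩ := exists_isFiniteSymmGen (Wreath (Multiplicative ℤ) (Multiplicative ℤ × D))
  obtain ⟨hlip, hqi⟩ := biLipschitzEquivalent_and_isQuasiIsometry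
    (Wreath.boundedDisplacement_congrLamp hσ hbd)
    (Wreath.congrLamp_symm (C := Multiplicative ℤ) σ hσ ▸
      Wreath.boundedDisplacement_congrLamp _ hbd') hSG hSH
  exact ⟨inferInstance, inferInstance, ⟨SG, SH, hSG, hSH, hlip, _, hqi⟩,
    Wreath.isSolvable _ _, fun h => hD (Wreath.isSolvable_of_virtuallySolvable
      (MonoidHom.snd _ _) (MonoidHom.inr _ _) (fun _ => rfl) h)⟩
end

section
/- Let D be a finite group that is not solvable, and let ⊕_ℤ D denote the direct sum of countably many copies of D indexed by ℤ. Then no subgroup of finite index in ⊕_ℤ D is solvable. In particular, for any finite-index subgroup X of ⊕_ℤ D there exists an index i ∈ ℤ such that the projection π_i : ⊕_ℤ D → D onto the i-th component restricts to a surjection from X onto D. -/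
/-- If `D` is a finite non-solvable group, then no finite-index subgroup
`X` of `⊕_ℤ D` is solvable; in particular some coordinate projection `π_i` restricts to
a surjection of `X` onto `D`. -/
theorem directSum_finiteIndex_not_solvable
    (D : Type*) [Group D] [Finite D] (hD : ¬ IsSolvable D)
    (X : Subgroup (FinSupp (Multiplicative ℤ) D)) (hX : X.FiniteIndex) :
    ¬ IsSolvable X ∧
    ∃ i : Multiplicative ℤ, Function.Surjective (fun x : X => x.1.1 i) := by
  have hX' : Finite (FinSupp (Multiplicative ℤ) D ⧸ X) := Subgroup.finite_quotient_of_finiteIndex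
  classical
  let single : Multiplicative ℤ → D → FinSupp (Multiplicative ℤ) D := fun i d =>
    ⟨Pi.mulSingle i d, (Set.finite_singleton i).subset Pi.mulSupport_mulSingle_subset⟩
  obtain ⟨i, j, hij, h⟩ := Finite.exists_ne_map_eq_of_infinite
    fun i d => (single i d : FinSupp (Multiplicative ℤ) D ⧸ X)
  have hsurj : Function.Surjective (fun x : X => x.1.1 j) := fun d =>
    ⟨⟨_, QuotientGroup.eq.1 (congrFun h d)⟩, by simp [single, Pi.mulSingle_eq_of_ne hij.symm]⟩
  refine ⟨fun hs => hD ?_, j, hsurj⟩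
  let π : X →* D := ((Pi.evalMonoidHom (fun _ : Multiplicative ℤ => D) j).comp
    (FinSupp (Multiplicative ℤ) D).subtype).comp X.subtype
  have : Group.IsSolvable X := hs
  exact Group.isSolvable_of_surjective (f := π) hsurj
end

section
/- Let A and B be finite groups with |A| = |B| such that A is solvable and B is not solvable, each equipped with the generating set consisting of all of its elements. Then the groups G = ℤ ≀ A and H = ℤ ≀ B admit finite generating sets for which their Cayley graphs are isometric (as metric spaces), while G is solvable and H is not virtually solvable. -/
theorem exists_list_of_adj {G H : Type*} [Group G] [Group H] {S : Set G} {T : Set H} (φ : G → H)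
    (hφ : ∀ x y, x * y⁻¹ ∈ S → φ x * (φ y)⁻¹ ∈ T) (l : List G) (hl : ∀ s ∈ l, s ∈ S) (y : G) :
    ∃ l' : List H, (∀ s ∈ l', s ∈ T) ∧ l'.length = l.length ∧
      l'.prod = φ (l.prod * y) * (φ y)⁻¹ := by
  induction l with
  | nil => exact ⟨[], by simp⟩
  | cons s l ih =>
    obtain ⟨l', hl', hlen, hprod⟩ := ih fun t ht => hl t (by simp [ht])
    refine ⟨φ (s * (l.prod * y)) * (φ (l.prod * y))⁻¹ :: l', ?_, by simp [hlen], ?_⟩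
    · have := hφ (s * (l.prod * y)) (l.prod * y)
        (by rw [mul_inv_cancel_right]; exact hl s (by simp))
      simpa [this] using hl'
    · simp [hprod, mul_assoc]

/-- A bijection preserving adjacency in the Cayley graphs preserves the word metrics. -/
theorem wordDist_eq_of_adj_iff {G H : Type*} [Group G] [Group H] {SG : Set G} {SH : Set H}
    (ψ : G ≃ H) (h : ∀ x y, ψ x * (ψ y)⁻¹ ∈ SH ↔ x * y⁻¹ ∈ SG) (x y : G) :
    wordDist SH (ψ x) (ψ y) = wordDist SG x y := by
  unfold wordDist wordLength
  congr 1
  ext n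
  constructor
  · rintro ⟨l, hl, rfl, hprod⟩
    obtain ⟨l', hl', hlen, hprod'⟩ := exists_list_of_adj ψ.symm
      (fun u v huv => (h _ _).1 (by simpa using huv)) l hl (ψ y)
    exact ⟨l', hl', hlen, by simpa [hprod] using hprod'⟩
  · rintro ⟨l, hl, rfl, hprod⟩
    obtain ⟨l', hl', hlen, hprod'⟩ := exists_list_of_adj ψ (fun u v => (h u v).2) l hl y
    exact ⟨l', hl', hlen, by simpa [hprod] using hprod'⟩

namespace Wreath

section Lamps

variable {C A : Type*} [Group C] [Group A]

theorem shiftHom_apply (c : C) (f : FinSupp C A) (x : C) :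
    (shiftHom C A c f : C → A) x = (f : C → A) (x * c) := rfl

open Classical in
/-- The finitely supported function with value `a` at `c` and `1` elsewhere. -/
noncomputable def lamp (c : C) (a : A) : FinSupp C A :=
  ⟨Pi.mulSingle c a, (Set.finite_singleton c).subset Pi.mulSupport_mulSingle_subset⟩

@[simp]
theorem lamp_same (c : C) (a : A) : (lamp c a : C → A) c = a := by
  classical exact Pi.mulSingle_eq_same (M := fun _ : C => A) c a

theorem lamp_of_ne {c x : C} (h : x ≠ c) (a : A) : (lamp c a : C → A) x = 1 := by
  classical exact Pi.mulSingle_eq_of_ne (M := fun _ : C => A) h a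

theorem inl_lamp (c : C) (a : A) :
    (SemidirectProduct.inl (lamp c a) : Wreath C A) =
      SemidirectProduct.inr c⁻¹ * SemidirectProduct.inl (lamp 1 a) * SemidirectProduct.inr c := by
  have h : shiftHom C A c⁻¹ (lamp 1 a) = lamp c a := by
    ext x
    rw [shiftHom_apply]
    by_cases hx : x = c
    · subst hx; simp
    · rw [lamp_of_ne hx, lamp_of_ne (by simpa [mul_inv_eq_one] using hx)]
  rw [← h, SemidirectProduct.inl_aut, inv_inv]

/-- The switch-or-walk generators: change the lamp at the origin, or shift by an element
of `T`. -/
def switchWalk (A : Type*) [Group A] (T : Set C) : Set (Wreath C A) :=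
  {g | (g.right = 1 ∧ ∀ z, z ≠ 1 → (g.left : C → A) z = 1) ∨ (g.left = 1 ∧ g.right ∈ T)}

theorem mul_inv_mem_switchWalk {T : Set C} {x y : Wreath C A} :
    x * y⁻¹ ∈ switchWalk A T ↔
      (x.right = y.right ∧ ∀ z, z ≠ 1 → (x.left : C → A) z = (y.left : C → A) z) ∨
      ((∀ z, (x.left : C → A) z = (y.left : C → A) (z * (x.right * y.right⁻¹))) ∧
        x.right * y.right⁻¹ ∈ T) := by
  have hval : ∀ z, ((x * y⁻¹).left : C → A) z =
      (x.left : C → A) z * ((y.left : C → A) (z * (x.right * y.right⁻¹)))⁻¹ := by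
    intro z
    rw [SemidirectProduct.mul_left, SemidirectProduct.inv_left, ← mul_assoc]
    rfl
  have hright : (x * y⁻¹).right = x.right * y.right⁻¹ := rfl
  have hleft : (x * y⁻¹).left = 1 ↔ ∀ z, ((x * y⁻¹).left : C → A) z = 1 := by
    rw [Subtype.ext_iff, funext_iff]; rfl
  unfold switchWalk
  rw [Set.mem_ofPred_eq, hleft, hright]
  simp only [hval, mul_inv_eq_one]
  refine or_congr (and_congr_right fun h => ?_) Iff.rfl
  simp [h]

theorem isFiniteSymmGen_switchWalk [Finite A] {T : Set C} (hT : IsFiniteSymmGen T) :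
    IsFiniteSymmGen (switchWalk A T) := by
  obtain ⟨hfin, hsymm, hgen⟩ := hT
  have hlamp : ∀ a : A, (SemidirectProduct.inl (lamp 1 a) : Wreath C A) ∈ switchWalk A T :=
    fun a => Or.inl ⟨rfl, fun z hz => lamp_of_ne hz a⟩
  refine ⟨?_, ?_, ?_⟩
  · refine ((Set.finite_range fun a : A => (SemidirectProduct.inl (lamp 1 a) : Wreath C A)).union
      (hfin.image SemidirectProduct.inr)).subset ?_
    rintro g (⟨hr, hl⟩ | ⟨hl, hr⟩)
    · refine Or.inl ⟨(g.left : C → A) 1, SemidirectProduct.ext (Subtype.ext (funext fun z => ?_))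
        hr.symm⟩
      by_cases hz : z = 1
      · subst hz; simp
      · rw [hl z hz]; exact lamp_of_ne hz _
    · exact Or.inr ⟨g.right, hr, SemidirectProduct.ext hl.symm rfl⟩
  · intro g hg
    rw [← one_mul g⁻¹, mul_inv_mem_switchWalk]
    rcases hg with ⟨hr, hl⟩ | ⟨hl, hr⟩
    · exact Or.inl ⟨hr.symm, fun z hz => (hl z hz).symm⟩
    · refine Or.inr ⟨fun z => by rw [hl]; rfl, by simpa using hsymm _ hr⟩
  · have hinr : ∀ c : C,
        (SemidirectProduct.inr c : Wreath C A) ∈ Subgroup.closure (switchWalk A T) := by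
      intro c
      have hle : Subgroup.closure T ≤
          (Subgroup.closure (switchWalk A T)).comap SemidirectProduct.inr :=
        (Subgroup.closure_le _).2 fun t ht => Subgroup.subset_closure (Or.inr ⟨rfl, ht⟩)
      exact hle (hgen ▸ Subgroup.mem_top c)
    have hlamp' : ∀ (c : C) (a : A), (SemidirectProduct.inl (lamp c a) : Wreath C A) ∈
        Subgroup.closure (switchWalk A T) := by
      intro c a
      rw [inl_lamp]
      exact mul_mem (mul_mem (hinr _) (Subgroup.subset_closure (hlamp a))) (hinr _)
    have hinl : ∀ s : Set C, s.Finite → ∀ f : FinSupp C A,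
        Function.mulSupport (f : C → A) ⊆ s →
        (SemidirectProduct.inl f : Wreath C A) ∈ Subgroup.closure (switchWalk A T) := by
      intro s hs
      induction s, hs using Set.Finite.induction_on with
      | empty =>
        intro f hf
        have : f = 1 := Subtype.ext (Function.mulSupport_eq_empty_iff.1 (Set.subset_empty_iff.1 hf))
        rw [this, map_one]
        exact one_mem _
      | @insert c s _ _ ih =>
        intro f hf
        rw [← mul_inv_cancel_left (lamp c ((f : C → A) c)) f, map_mul]
        refine mul_mem (hlamp' _ _) (ih _ fun x hx => ?_)
        have hx' : ((lamp c ((f : C → A) c) : C → A) x)⁻¹ * (f : C → A) x ≠ 1 := hx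
        by_cases hxc : x = c
        · subst hxc; simp at hx'
        · rw [lamp_of_ne hxc, inv_one, one_mul] at hx'
          exact (hf hx').resolve_left hxc
    refine eq_top_iff.2 fun g _ => ?_
    rw [← SemidirectProduct.inl_left_mul_inr_right g]
    exact mul_mem (hinl _ g.left.2 _ subset_rfl) (hinr _)

/-- Apply a bijection fixing the identity to all lamps. -/
def mapLamps {B : Type*} [Group B] (σ : A ≃ B) (hσ : σ 1 = 1) : Wreath C A ≃ Wreath C B where
  toFun g := ⟨⟨σ ∘ (g.left : C → A),
    g.left.2.subset (Function.mulSupport_comp_subset hσ _)⟩, g.right⟩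
  invFun g := ⟨⟨σ.symm ∘ (g.left : C → B), g.left.2.subset
    (Function.mulSupport_comp_subset (σ.symm_apply_eq.2 hσ.symm) _)⟩, g.right⟩
  left_inv _ := SemidirectProduct.ext (Subtype.ext (funext fun _ => σ.symm_apply_apply _)) rfl
  right_inv _ := SemidirectProduct.ext (Subtype.ext (funext fun _ => σ.apply_symm_apply _)) rfl

theorem wordDist_mapLamps {B : Type*} [Group B] (σ : A ≃ B) (hσ : σ 1 = 1) (T : Set C)
    (x y : Wreath C A) :
    wordDist (switchWalk B T) (mapLamps σ hσ x) (mapLamps σ hσ y) =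
      wordDist (switchWalk A T) x y := by
  refine wordDist_eq_of_adj_iff _ (fun u v => ?_) x y
  rw [mul_inv_mem_switchWalk, mul_inv_mem_switchWalk]
  simp [mapLamps]

theorem isSolvable_pi {ι : Type*} [Group.IsSolvable A] : Group.IsSolvable (ι → A) := by
  have hle : ∀ n (f : ι → A), f ∈ derivedSeries (ι → A) n → ∀ i, f i ∈ derivedSeries A n :=
    fun n f hf i => map_derivedSeries_le_derivedSeries (Pi.evalMonoidHom (fun _ : ι => A) i) n
      (Subgroup.mem_map_of_mem _ hf)
  obtain ⟨n, hn⟩ := Group.IsSolvable.solvable (G := A)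
  refine ⟨n, (Subgroup.eq_bot_iff_forall _).2 fun f hf => funext fun i => ?_⟩
  simpa [hn] using hle n f hf i

theorem isSolvable_s8 [Group.IsSolvable C] [Group.IsSolvable A] : Group.IsSolvable (Wreath C A) := by
  have : Group.IsSolvable (C → A) := isSolvable_pi
  exact Group.isSolvable_of_ker_le_range SemidirectProduct.inl SemidirectProduct.rightHom
    SemidirectProduct.range_inl_eq_ker_rightHom.ge

theorem isSolvable_of_virtuallySolvable_s8 [Infinite C] (h : VirtuallySolvable (Wreath C A)) :
    Group.IsSolvable A := by
  obtain ⟨K, hfin, hsolv⟩ := h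
  have : Group.IsSolvable K := hsolv
  by_contra hA
  have hmiss : ∀ z : C, ∃ a : A, ∀ g ∈ K.comap SemidirectProduct.inl, (g : C → A) z ≠ a := by
    intro z
    by_contra! hz
    refine hA ?_
    let L : Subgroup (FinSupp C A) := K.comap SemidirectProduct.inl
    have hL : Group.IsSolvable L := Group.isSolvable_of_isSolvable_injective
      (f := (SemidirectProduct.inl : FinSupp C A →* Wreath C A).subgroupComap K)
      fun u v huv => Subtype.ext (SemidirectProduct.inl_injective (congrArg Subtype.val huv))
    refine Group.isSolvable_of_surjective
      (f := (Pi.evalMonoidHom (fun _ : C => A) z).comp ((FinSupp C A).subtype.comp L.subtype)) ?_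
    intro a
    obtain ⟨g, hg, hga⟩ := hz a
    exact ⟨⟨g, hg⟩, hga⟩
  choose a ha using hmiss
  obtain ⟨z, w, hne, hzw⟩ := Finite.exists_ne_map_eq_of_infinite fun z : C =>
    (QuotientGroup.mk (SemidirectProduct.inl (lamp z (a z))) : Wreath C A ⧸ K)
  have hmem : (lamp w (a w))⁻¹ * lamp z (a z) ∈ K.comap SemidirectProduct.inl := by
    simpa using QuotientGroup.eq.1 hzw.symm
  refine ha z _ hmem ?_
  change ((lamp w (a w) : C → A) z)⁻¹ * (lamp z (a z) : C → A) z = a z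
  rw [lamp_of_ne hne, lamp_same, inv_one, one_mul]

end Lamps

end Wreath

theorem isFiniteSymmGen_multiplicative_int :
    IsFiniteSymmGen ({Multiplicative.ofAdd 1, Multiplicative.ofAdd (-1)} :
      Set (Multiplicative ℤ)) := by
  refine ⟨by simp, ?_, ?_⟩
  · rintro s (rfl | rfl)
    · exact Or.inr rfl
    · exact Or.inl rfl
  · refine eq_top_iff.2 fun c _ => ?_
    have : c = Multiplicative.ofAdd (1 : ℤ) ^ c.toAdd := by
      rw [← ofAdd_zsmul]; simp
    rw [this]
    exact Subgroup.zpow_mem _ (Subgroup.subset_closure (Set.mem_insert _ _)) _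

/-- Let `A`, `B` be finite groups of equal cardinality with `A` solvable
and `B` not solvable. Then `G = ℤ ≀ A` and `H = ℤ ≀ B` admit finite symmetric generating
sets with isometric Cayley graphs (a bijection preserving the word metrics), while `G`
is solvable and `H` is not virtually solvable. -/
theorem cayley_isometric_solvable_vs_not
    (A B : Type*) [Group A] [Group B] [Finite A] [Finite B]
    (hcard : Nat.card A = Nat.card B) (hA : IsSolvable A) (hB : ¬ IsSolvable B) :
    (∃ (SG : Set (Wreath (Multiplicative ℤ) A)) (SH : Set (Wreath (Multiplicative ℤ) B)),
      IsFiniteSymmGen SG ∧ IsFiniteSymmGen SH ∧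
      ∃ ψ : Wreath (Multiplicative ℤ) A ≃ Wreath (Multiplicative ℤ) B,
        ∀ x y : Wreath (Multiplicative ℤ) A, wordDist SH (ψ x) (ψ y) = wordDist SG x y) ∧
    IsSolvable (Wreath (Multiplicative ℤ) A) ∧
    ¬ VirtuallySolvable (Wreath (Multiplicative ℤ) B) := by
  have : Group.IsSolvable A := hA
  refine ⟨?_, Wreath.isSolvable_s8, fun h => hB (Wreath.isSolvable_of_virtuallySolvable_s8 h)⟩
  obtain ⟨τ⟩ := Finite.card_eq.1 hcard
  have hσ : (τ.trans (Equiv.mulRight (τ 1)⁻¹)) 1 = 1 := by simp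
  exact ⟨_, _, Wreath.isFiniteSymmGen_switchWalk isFiniteSymmGen_multiplicative_int,
    Wreath.isFiniteSymmGen_switchWalk isFiniteSymmGen_multiplicative_int,
    Wreath.mapLamps _ hσ, Wreath.wordDist_mapLamps _ hσ _⟩
end
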